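/- The series ∑_{k=1}^∞ h_k³/k² converges and equals (21/8)·ζ(2)·ζ(3). -/

import Mathlib

open Finset Real

noncomputable def H (k : ℕ) : ℝ := ∑ j ∈ Finset.range k, (1 : ℝ) / ((j : ℝ) + 1)
noncomputable def H2 (k : ℕ) : ℝ := ∑ j ∈ Finset.range k, (1 : ℝ) / ((j : ℝ) + 1) ^ 2
noncomputable def H3 (k : ℕ) : ℝ := ∑ j ∈ Finset.range k, (1 : ℝ) / ((j : ℝ) + 1) ^ 3
noncomputable def h (k : ℕ) : ℝ := ∑ j ∈ Finset.range k, (1 : ℝ) / (2 * (j : ℝ) + 1)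
noncomputable def h2 (k : ℕ) : ℝ := ∑ j ∈ Finset.range k, (1 : ℝ) / (2 * (j : ℝ) + 1) ^ 2
noncomputable def h3 (k : ℕ) : ℝ := ∑ j ∈ Finset.range k, (1 : ℝ) / (2 * (j : ℝ) + 1) ^ 3
noncomputable def zeta (s : ℕ) : ℝ := ∑' n : ℕ, (1 : ℝ) / ((n : ℝ) + 1) ^ s

open Filter Topology

/-- The Dirichlet lambda value `∑ 1 / (2n+1)^s`. -/
noncomputable def oddZeta (s : ℕ) : ℝ := ∑' n : ℕ, (1 : ℝ) / (2 * (n : ℝ) + 1) ^ s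

/-- The generating product `∏_{j<k} (2j+1-z)/(2j+1+z)`, whose Taylor coefficients at `z = 0` are
polynomials in the odd harmonic sums. -/
noncomputable def oddRatio (z : ℝ) (k : ℕ) : ℝ :=
  ∏ j ∈ Finset.range k, (2 * (j : ℝ) + 1 - z) / (2 * (j : ℝ) + 1 + z)

/-- The series `∑_{k ≥ 1} oddRatio z k / k²`. -/
noncomputable def ratioSeries (z : ℝ) : ℝ := ∑' k : ℕ, oddRatio z (k + 1) / ((k : ℝ) + 1) ^ 2

/-- The series `∑ 2 / (2n+1+z)²`. -/
noncomputable def shiftedSquares (z : ℝ) : ℝ := ∑' n : ℕ, 2 / (2 * (n : ℝ) + 1 + z) ^ 2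

lemma summable_one_div_succ_sq : Summable fun k : ℕ => (1 : ℝ) / ((k : ℝ) + 1) ^ 2 := by
  simpa using (summable_nat_add_iff 1).2 (Real.summable_one_div_nat_pow.2 one_lt_two)

lemma summable_one_div_odd_pow {s : ℕ} (hs : 1 < s) :
    Summable fun n : ℕ => (1 : ℝ) / (2 * (n : ℝ) + 1) ^ s := by
  have := (Real.summable_one_div_nat_pow.2 hs).comp_injective
    (i := fun n : ℕ => 2 * n + 1) (fun a b hab => by simp at hab; omega)
  simpa [Function.comp_def] using this

lemma summable_shiftedSquares {z : ℝ} (hz : 0 ≤ z) :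
    Summable fun n : ℕ => 2 / (2 * (n : ℝ) + 1 + z) ^ 2 := by
  refine Summable.of_nonneg_of_le (fun n => by positivity) (fun n => ?_)
    ((summable_one_div_odd_pow one_lt_two).mul_left 2)
  rw [mul_one_div]
  exact div_le_div_of_nonneg_left zero_le_two (by positivity)
    (pow_le_pow_left₀ (by positivity) (le_add_of_nonneg_right hz) 2)

lemma abs_oddRatio_le_one {z : ℝ} (hz : 0 ≤ z) (k : ℕ) : |oddRatio z k| ≤ 1 := by
  rw [oddRatio, Finset.abs_prod]
  refine Finset.prod_le_one (fun _ _ => abs_nonneg _) (fun j _ => ?_)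
  have hj : (0 : ℝ) ≤ j := j.cast_nonneg
  rw [abs_div, abs_of_pos (by positivity : 0 < 2 * (j : ℝ) + 1 + z), div_le_one (by positivity),
    abs_le]
  constructor <;> linarith

lemma summable_oddRatio {z : ℝ} (hz : 0 ≤ z) :
    Summable fun k : ℕ => oddRatio z (k + 1) / ((k : ℝ) + 1) ^ 2 := by
  refine Summable.of_norm_bounded summable_one_div_succ_sq (fun k => ?_)
  rw [norm_div, Real.norm_eq_abs, Real.norm_of_nonneg (by positivity)]
  gcongr
  exact abs_oddRatio_le_one hz _

lemma oddRatio_succ (z : ℝ) (k : ℕ) :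
    oddRatio z (k + 1) = oddRatio z k * ((2 * (k : ℝ) + 1 - z) / (2 * (k : ℝ) + 1 + z)) :=
  Finset.prod_range_succ _ _

lemma oddRatio_add_two {z : ℝ} (hz : 0 ≤ z) (m : ℕ) :
    oddRatio (z + 2) (m + 1) =
      -(1 + z) ^ 2 * oddRatio z m / ((2 * (m : ℝ) + 3 + z) * (2 * (m : ℝ) + 1 + z)) := by
  induction m with
  | zero =>
    simp only [oddRatio, zero_add, Finset.prod_range_one, Finset.prod_range_zero, Nat.cast_zero]
    have : 1 + z ≠ 0 := by positivity
    have : 3 + z ≠ 0 := by positivity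
    have : 1 + (z + 2) ≠ 0 := by positivity
    field_simp
    ring
  | succ m ih =>
    rw [oddRatio_succ (z + 2), ih, oddRatio_succ z]
    have : 2 * (m : ℝ) + 1 + z ≠ 0 := by positivity
    have : 2 * (m : ℝ) + 3 + z ≠ 0 := by positivity
    have : 2 * (m : ℝ) + 5 + z ≠ 0 := by positivity
    have h1 : 2 * ((m + 1 : ℕ) : ℝ) + 1 + (z + 2) = 2 * (m : ℝ) + 5 + z := by push_cast; ring
    have h2 : 2 * ((m + 1 : ℕ) : ℝ) + 1 - (z + 2) = 2 * (m : ℝ) + 1 - z := by push_cast; ring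
    have h3 : 2 * ((m + 1 : ℕ) : ℝ) + 3 + z = 2 * (m : ℝ) + 5 + z := by push_cast; ring
    have h4 : 2 * ((m + 1 : ℕ) : ℝ) + 1 + z = 2 * (m : ℝ) + 3 + z := by push_cast; ring
    rw [h1, h2, h3, h4]
    field_simp

/-- A Wilf–Zeilberger certificate for the recurrence of `ratioSeries`. -/
lemma oddRatio_sub_shift {z : ℝ} (hz : 0 ≤ z) (m : ℕ) :
    oddRatio z (m + 1) / ((m : ℝ) + 1) ^ 2 - oddRatio (z + 2) (m + 1) / ((m : ℝ) + 1) ^ 2 =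
      2 * oddRatio z m / ((1 + z) * (2 * (m : ℝ) + 1 + z)) -
        2 * oddRatio z (m + 1) / ((1 + z) * (2 * ((m + 1 : ℕ) : ℝ) + 1 + z)) := by
  rw [oddRatio_add_two hz, oddRatio_succ]
  have : 1 + z ≠ 0 := by positivity
  have : 2 * (m : ℝ) + 1 + z ≠ 0 := by positivity
  have : 2 * (m : ℝ) + 3 + z ≠ 0 := by positivity
  have : (m : ℝ) + 1 ≠ 0 := by positivity
  have h4 : 2 * ((m + 1 : ℕ) : ℝ) + 1 + z = 2 * (m : ℝ) + 3 + z := by push_cast; ring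
  rw [h4]
  field_simp
  ring

lemma ratioSeries_sub_shift {z : ℝ} (hz : 0 ≤ z) :
    ratioSeries z - ratioSeries (z + 2) = 2 / (1 + z) ^ 2 := by
  have hz2 : 0 ≤ z + 2 := by positivity
  have hs := (summable_oddRatio hz).sub (summable_oddRatio hz2)
  rw [ratioSeries, ratioSeries, ← (summable_oddRatio hz).tsum_sub (summable_oddRatio hz2)]
  refine tendsto_nhds_unique hs.hasSum.tendsto_sum_nat ?_
  set V : ℕ → ℝ := fun m => 2 * oddRatio z m / ((1 + z) * (2 * (m : ℝ) + 1 + z)) with hV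
  have hsum : ∀ n, ∑ m ∈ Finset.range n, (oddRatio z (m + 1) / ((m : ℝ) + 1) ^ 2 -
      oddRatio (z + 2) (m + 1) / ((m : ℝ) + 1) ^ 2) = V 0 - V n := by
    intro n
    rw [← Finset.sum_range_sub' V]
    exact Finset.sum_congr rfl fun m _ => oddRatio_sub_shift hz m
  simp_rw [hsum]
  have hV0 : V 0 = 2 / (1 + z) ^ 2 := by simp [hV, oddRatio, sq]
  have hlim : Tendsto V atTop (𝓝 0) := by
    refine squeeze_zero_norm (a := fun m : ℕ => 2 * (1 / ((m : ℝ) + 1))) (fun m => ?_) ?_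
    · rw [hV, norm_div, norm_mul, Real.norm_eq_abs, Real.norm_eq_abs, Real.norm_eq_abs,
        abs_of_pos (by positivity : 0 < (1 + z) * (2 * (m : ℝ) + 1 + z)), abs_two, mul_one_div]
      have := abs_oddRatio_le_one hz m
      gcongr
      · linarith
      · have hm : (0 : ℝ) ≤ m := m.cast_nonneg
        nlinarith [mul_nonneg hz hm]
    · simpa using tendsto_one_div_add_atTop_nhds_zero_nat.const_mul (2 : ℝ)
  simpa [hV0] using hlim.const_sub (V 0)

lemma shiftedSquares_sub_shift {z : ℝ} (hz : 0 ≤ z) :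
    shiftedSquares z - shiftedSquares (z + 2) = 2 / (1 + z) ^ 2 := by
  rw [shiftedSquares, (summable_shiftedSquares hz).tsum_eq_zero_add, shiftedSquares]
  have : ∀ n : ℕ, 2 / (2 * ((n + 1 : ℕ) : ℝ) + 1 + z) ^ 2 = 2 / (2 * (n : ℝ) + 1 + (z + 2)) ^ 2 := by
    intro n; congr 2; push_cast; ring
  simp_rw [this]
  simp

lemma tendsto_oddRatio_atTop (k : ℕ) :
    Tendsto (fun z => oddRatio z k) atTop (𝓝 ((-1) ^ k)) := by
  have h1 : ∀ c : ℝ, Tendsto (fun z : ℝ => (c - z) / (c + z)) atTop (𝓝 (-1)) := by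
    intro c
    have h2 : Tendsto (fun z : ℝ => 2 * c / (c + z) - 1) atTop (𝓝 (0 - 1)) :=
      ((tendsto_atTop_add_const_left _ c tendsto_id).const_div_atTop (2 * c)).sub_const 1
    rw [zero_sub] at h2
    refine h2.congr' ?_
    filter_upwards [eventually_gt_atTop (-c)] with z hz
    have : c + z ≠ 0 := by linarith
    field_simp
    ring
  simpa [oddRatio] using tendsto_finsetProd (Finset.range k) fun (j : ℕ) _ => h1 (2 * (j : ℝ) + 1)

lemma tendsto_ratioSeries_atTop :
    Tendsto ratioSeries atTop (𝓝 (∑' k : ℕ, (-1 : ℝ) ^ (k + 1) / ((k : ℝ) + 1) ^ 2)) := by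
  refine tendsto_tsum_of_dominated_convergence summable_one_div_succ_sq
    (fun k => (tendsto_oddRatio_atTop (k + 1)).div_const _) ?_
  filter_upwards [eventually_ge_atTop 0] with z hz k
  rw [norm_div, Real.norm_eq_abs, Real.norm_of_nonneg (by positivity)]
  gcongr
  exact abs_oddRatio_le_one hz _

lemma tendsto_shiftedSquares_atTop : Tendsto shiftedSquares atTop (𝓝 0) := by
  have h0 : (0 : ℝ) = ∑' _ : ℕ, (0 : ℝ) := tsum_zero.symm
  rw [h0]
  refine tendsto_tsum_of_dominated_convergence ((summable_one_div_odd_pow one_lt_two).mul_left 2)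
    (fun n => ?_) ?_
  · exact ((tendsto_pow_atTop two_ne_zero).comp
      (tendsto_atTop_add_const_left _ (2 * (n : ℝ) + 1) tendsto_id)).const_div_atTop 2
  · filter_upwards [eventually_ge_atTop 0] with z hz n
    rw [Real.norm_of_nonneg (by positivity), mul_one_div]
    exact div_le_div_of_nonneg_left zero_le_two (by positivity)
      (pow_le_pow_left₀ (by positivity) (le_add_of_nonneg_right hz) 2)

/-- A degenerate case of Dixon's theorem. -/
lemma ratioSeries_eq {z : ℝ} (hz : 0 ≤ z) :
    ratioSeries z =
      shiftedSquares z + ∑' k : ℕ, (-1 : ℝ) ^ (k + 1) / ((k : ℝ) + 1) ^ 2 := by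
  have hconst : ∀ N : ℕ, ratioSeries (z + 2 * N) - shiftedSquares (z + 2 * N) =
      ratioSeries z - shiftedSquares z := by
    intro N
    induction N with
    | zero => simp
    | succ N ih =>
      have hzN : 0 ≤ z + 2 * N := by positivity
      have h1 := ratioSeries_sub_shift hzN
      have h2 := shiftedSquares_sub_shift hzN
      have h3 : z + 2 * ((N + 1 : ℕ) : ℝ) = z + 2 * N + 2 := by push_cast; ring
      rw [h3]
      linarith
  have hlim : Tendsto (fun N : ℕ => z + 2 * (N : ℝ)) atTop atTop :=
    tendsto_atTop_add_const_left _ _ (tendsto_natCast_atTop_atTop.const_mul_atTop two_pos)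
  have h1 := (tendsto_ratioSeries_atTop.sub tendsto_shiftedSquares_atTop).comp hlim
  have h2 := tendsto_nhds_unique h1 (tendsto_const_nhds.congr fun N => (hconst N).symm)
  linarith

lemma h_nonneg (k : ℕ) : 0 ≤ h k := Finset.sum_nonneg fun _ _ => by positivity

lemma h_succ (k : ℕ) : h (k + 1) = h k + 1 / (2 * (k : ℝ) + 1) := Finset.sum_range_succ _ _

lemma h3_succ (k : ℕ) : h3 (k + 1) = h3 k + (1 / (2 * (k : ℝ) + 1)) ^ 3 := by
  rw [h3, Finset.sum_range_succ, one_div_pow, h3]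

lemma h3_nonneg (k : ℕ) : 0 ≤ h3 k := Finset.sum_nonneg fun _ _ => by positivity

lemma h3_le_h_cube (k : ℕ) : h3 k ≤ h k ^ 3 := by
  induction k with
  | zero => simp [h, h3]
  | succ k ih =>
    rw [h_succ, h3_succ]
    have h0 := h_nonneg k
    have hr : 0 ≤ 1 / (2 * (k : ℝ) + 1) := by positivity
    generalize 1 / (2 * (k : ℝ) + 1) = r at *
    have : 0 ≤ 3 * h k ^ 2 * r + 3 * h k * r ^ 2 := by positivity
    nlinarith

lemma one_le_h_succ (k : ℕ) : 1 ≤ h (k + 1) := by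
  induction k with
  | zero => simp [h]
  | succ k ih =>
    rw [h_succ]
    have : 0 ≤ 1 / (2 * ((k + 1 : ℕ) : ℝ) + 1) := by positivity
    linarith

lemma h_le_rpow {k : ℕ} (hk : 1 ≤ k) : h k ≤ 9 * (k : ℝ) ^ (1 / 8 : ℝ) := by
  have hk' : (1 : ℝ) ≤ k := by exact_mod_cast hk
  have h1 : h k ≤ (harmonic k : ℝ) := by
    rw [harmonic, h]
    push_cast
    refine Finset.sum_le_sum fun j _ => ?_
    rw [← one_div]
    gcongr
    have : (0 : ℝ) ≤ j := j.cast_nonneg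
    linarith
  have h2 := harmonic_le_one_add_log k
  have h3 := Real.log_le_rpow_div (x := k) (by positivity) (by norm_num : (0 : ℝ) < 1 / 8)
  have h4 := Real.one_le_rpow hk' (by norm_num : (0 : ℝ) ≤ 1 / 8)
  rw [div_div_eq_mul_div, div_one] at h3
  linarith

lemma summable_h_pow_four :
    Summable fun k : ℕ => h (k + 1) ^ 4 / ((k : ℝ) + 1) ^ 2 := by
  have hs : Summable fun k : ℕ => 9 ^ 4 * (1 / ((k + 1 : ℕ) : ℝ) ^ (3 / 2 : ℝ)) :=
    ((summable_nat_add_iff 1).2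
      (Real.summable_one_div_nat_rpow.2 (by norm_num : (1 : ℝ) < 3 / 2))).mul_left _
  refine hs.of_nonneg_of_le (fun k => by positivity) fun k => ?_
  have hk : (0 : ℝ) < ((k + 1 : ℕ) : ℝ) := by positivity
  have h1 : h (k + 1) ^ 4 ≤ (9 * ((k + 1 : ℕ) : ℝ) ^ (1 / 8 : ℝ)) ^ 4 := by
    have := h_nonneg (k + 1)
    gcongr
    exact h_le_rpow (by omega)
  have h2 : (((k + 1 : ℕ) : ℝ) ^ (1 / 8 : ℝ)) ^ 4 * ((k + 1 : ℕ) : ℝ) ^ (3 / 2 : ℝ) =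
      ((k : ℝ) + 1) ^ 2 := by
    rw [← Real.rpow_mul_natCast hk.le, ← Real.rpow_add hk]
    norm_num
  rw [mul_one_div, div_le_div_iff₀ (by positivity) (by positivity), ← h2]
  calc _ ≤ (9 * ((k + 1 : ℕ) : ℝ) ^ (1 / 8 : ℝ)) ^ 4 * ((k + 1 : ℕ) : ℝ) ^ (3 / 2 : ℝ) := by gcongr
    _ = _ := by ring

lemma summable_of_le_h_pow_four {f : ℕ → ℝ} (h0 : ∀ k, 0 ≤ f k)
    (hf : ∀ k, f k ≤ h (k + 1) ^ 4) : Summable fun k : ℕ => f k / ((k : ℝ) + 1) ^ 2 := by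
  refine summable_h_pow_four.of_nonneg_of_le (fun k => div_nonneg (h0 k) (by positivity))
    fun k => ?_
  gcongr
  exact hf k

lemma summable_h_pow {m : ℕ} (hm : m ≤ 4) :
    Summable fun k : ℕ => h (k + 1) ^ m / ((k : ℝ) + 1) ^ 2 :=
  summable_of_le_h_pow_four (fun _ => pow_nonneg (h_nonneg _) _)
    fun k => pow_le_pow_right₀ (one_le_h_succ k) hm

lemma summable_h3 : Summable fun k : ℕ => h3 (k + 1) / ((k : ℝ) + 1) ^ 2 :=
  summable_of_le_h_pow_four (fun _ => h3_nonneg _)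
    fun k => (h3_le_h_cube _).trans (pow_le_pow_right₀ (one_le_h_succ k) (by norm_num))

/-- The third-order Taylor expansion of `oddRatio` at `z = 0`. -/
lemma abs_oddRatio_sub_taylor_le {z : ℝ} (hz : 0 ≤ z) (k : ℕ) :
    |oddRatio z k - (1 - 2 * z * h k + 2 * z ^ 2 * h k ^ 2 -
      z ^ 3 * (4 / 3 * h k ^ 3 + 2 / 3 * h3 k))| ≤ 2 * z ^ 4 * h k ^ 4 := by
  induction k with
  | zero => simp [oddRatio, h, h3]
  | succ k ih =>
    rw [oddRatio_succ, h_succ, h3_succ]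
    have hg : |(2 * (k : ℝ) + 1 - z) / (2 * (k : ℝ) + 1 + z)| ≤ 1 := by
      have hk : (0 : ℝ) ≤ k := k.cast_nonneg
      rw [abs_div, abs_of_pos (by positivity : 0 < 2 * (k : ℝ) + 1 + z), div_le_one (by positivity),
        abs_le]
      constructor <;> linarith
    have hφ : (2 * (k : ℝ) + 1 - z) / (2 * (k : ℝ) + 1 + z) =
        (1 - z * (1 / (2 * (k : ℝ) + 1))) / (1 + z * (1 / (2 * (k : ℝ) + 1))) := by
      field_simp
    rw [hφ] at hg ⊢
    have hx := h_nonneg k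
    have hq := h3_nonneg k
    have hqx := h3_le_h_cube k
    have hr : 0 ≤ 1 / (2 * (k : ℝ) + 1) := by positivity
    generalize 1 / (2 * (k : ℝ) + 1) = r at *
    generalize h k = x at *
    generalize h3 k = q at *
    generalize oddRatio z k = g at *
    have ht : 0 < 1 + z * r := by positivity
    set P := 1 - 2 * z * x + 2 * z ^ 2 * x ^ 2 - z ^ 3 * (4 / 3 * x ^ 3 + 2 / 3 * q) with hP
    set φ := (1 - z * r) / (1 + z * r) with hφ'
    set Q := r * (4 / 3 * x ^ 3 + 2 / 3 * q + 4 / 3 * (x + r) ^ 3 + 2 / 3 * (q + r ^ 3)) with hQ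
    have hQ0 : 0 ≤ Q := by positivity
    have hstep : g * φ - (1 - 2 * z * (x + r) + 2 * z ^ 2 * (x + r) ^ 2 -
        z ^ 3 * (4 / 3 * (x + r) ^ 3 + 2 / 3 * (q + r ^ 3))) =
        (g - P) * φ + z ^ 4 * Q / (1 + z * r) := by
      rw [hφ', hP, hQ]
      field_simp
      ring
    have hQle : Q ≤ 2 * ((x + r) ^ 4 - x ^ 4) := by
      have h1 : r * q ≤ r * x ^ 3 := by gcongr
      have h2 : 0 ≤ 4 * r * x ^ 3 + 8 * r ^ 2 * x ^ 2 + 4 * r ^ 3 * x := by positivity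
      rw [hQ]
      nlinarith [h1, h2]
    rw [hstep]
    calc _ ≤ |(g - P) * φ| + |z ^ 4 * Q / (1 + z * r)| := abs_add_le _ _
      _ ≤ 2 * z ^ 4 * x ^ 4 + z ^ 4 * Q := by
        gcongr
        · rw [abs_mul]
          calc _ ≤ |g - P| * 1 := by gcongr
            _ ≤ _ := by rw [mul_one]; exact ih
        · rw [abs_of_nonneg (by positivity)]
          exact div_le_self (by positivity) (by linarith [mul_nonneg hz hr])
      _ ≤ 2 * z ^ 4 * x ^ 4 + z ^ 4 * (2 * ((x + r) ^ 4 - x ^ 4)) := by gcongr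
      _ = _ := by ring

lemma abs_tsum_sub_tsum_le {f g e : ℕ → ℝ} (hf : Summable f) (hg : Summable g) (he : Summable e)
    (hle : ∀ k, |f k - g k| ≤ e k) : |∑' k, f k - ∑' k, g k| ≤ ∑' k, e k := by
  rw [← hf.tsum_sub hg]
  exact tsum_of_norm_bounded he.hasSum fun k => (Real.norm_eq_abs _).trans_le (hle k)

lemma abs_ratioSeries_sub_taylor_le {z : ℝ} (hz : 0 ≤ z) :
    |ratioSeries z - (∑' k : ℕ, h (k + 1) ^ 0 / ((k : ℝ) + 1) ^ 2 -
        2 * z * ∑' k : ℕ, h (k + 1) ^ 1 / ((k : ℝ) + 1) ^ 2 +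
        2 * z ^ 2 * ∑' k : ℕ, h (k + 1) ^ 2 / ((k : ℝ) + 1) ^ 2 -
        z ^ 3 * (4 / 3 * ∑' k : ℕ, h (k + 1) ^ 3 / ((k : ℝ) + 1) ^ 2 +
          2 / 3 * ∑' k : ℕ, h3 (k + 1) / ((k : ℝ) + 1) ^ 2))| ≤
      2 * z ^ 4 * ∑' k : ℕ, h (k + 1) ^ 4 / ((k : ℝ) + 1) ^ 2 := by
  have hT := ((((summable_h_pow (m := 0) (by norm_num)).hasSum.sub
    ((summable_h_pow (m := 1) (by norm_num)).hasSum.mul_left (2 * z))).add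
    ((summable_h_pow (m := 2) (by norm_num)).hasSum.mul_left (2 * z ^ 2))).sub
    ((((summable_h_pow (m := 3) (by norm_num)).hasSum.mul_left (4 / 3)).add
      (summable_h3.hasSum.mul_left (2 / 3))).mul_left (z ^ 3)))
  rw [← hT.tsum_eq, ← tsum_mul_left]
  refine abs_tsum_sub_tsum_le (summable_oddRatio hz) hT.summable
    (summable_h_pow_four.mul_left _) fun k => ?_
  have hk : (0 : ℝ) < ((k : ℝ) + 1) ^ 2 := by positivity
  have := div_le_div_of_nonneg_right (abs_oddRatio_sub_taylor_le hz (k + 1)) hk.le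
  rw [← abs_of_pos hk, ← abs_div, abs_of_pos hk] at this
  refine (le_of_eq ?_).trans (this.trans_eq ?_)
  · congr 1; ring
  · ring

lemma abs_shiftedSquares_sub_taylor_le {z : ℝ} (hz : 0 ≤ z) :
    |shiftedSquares z - (2 * oddZeta 2 - 4 * z * oddZeta 3 + 6 * z ^ 2 * oddZeta 4 -
      8 * z ^ 3 * oddZeta 5)| ≤ 10 * z ^ 4 * oddZeta 6 := by
  have hs : ∀ s : ℕ, 1 < s → HasSum (fun n : ℕ => (1 : ℝ) / (2 * (n : ℝ) + 1) ^ s) (oddZeta s) :=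
    fun s hs => (summable_one_div_odd_pow hs).hasSum
  have hT := ((((hs 2 (by norm_num)).mul_left 2).sub ((hs 3 (by norm_num)).mul_left (4 * z))).add
    ((hs 4 (by norm_num)).mul_left (6 * z ^ 2))).sub ((hs 5 (by norm_num)).mul_left (8 * z ^ 3))
  have h6 := (hs 6 (by norm_num)).mul_left (10 * z ^ 4)
  rw [← hT.tsum_eq, ← h6.tsum_eq]
  refine abs_tsum_sub_tsum_le (summable_shiftedSquares hz) hT.summable h6.summable fun n => ?_
  have ho : (0 : ℝ) < 2 * (n : ℝ) + 1 := by positivity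
  generalize 2 * (n : ℝ) + 1 = o at *
  have hoz : 0 < o + z := by positivity
  have : 2 / (o + z) ^ 2 - (2 * (1 / o ^ 2) - 4 * z * (1 / o ^ 3) + 6 * z ^ 2 * (1 / o ^ 4) -
      8 * z ^ 3 * (1 / o ^ 5)) = z ^ 4 * (10 * o + 8 * z) / (o ^ 5 * (o + z) ^ 2) := by
    field_simp
    ring
  rw [this, abs_of_nonneg (by positivity), mul_one_div, div_le_div_iff₀ (by positivity)
    (by positivity)]
  have h1 : (10 * o + 8 * z) * o ≤ 10 * (o + z) ^ 2 := by
    nlinarith [mul_nonneg hz ho.le, sq_nonneg z]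
  calc _ = z ^ 4 * o ^ 5 * ((10 * o + 8 * z) * o) := by ring
    _ ≤ z ^ 4 * o ^ 5 * (10 * (o + z) ^ 2) := by gcongr
    _ = _ := by ring

lemma cubic_coeff_eq_zero {a b c d C : ℝ}
    (hP : ∀ z, 0 ≤ z → |a + b * z + c * z ^ 2 + d * z ^ 3| ≤ C * z ^ 4) : d = 0 := by
  have hd : ∀ z, 0 < z → |d| ≤ 22 * C * z := by
    intro z hz
    have h0 := abs_le.1 (hP 0 le_rfl)
    have h1 := abs_le.1 (hP z hz.le)
    have h2 := abs_le.1 (hP (2 * z) (by positivity))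
    have h3 := abs_le.1 (hP (3 * z) (by positivity))
    have : |d| * z ^ 3 ≤ 22 * C * z * z ^ 3 := by
      rw [← abs_of_pos (pow_pos hz 3), ← abs_mul, abs_of_pos (pow_pos hz 3), abs_le]
      constructor <;> nlinarith
    exact le_of_mul_le_mul_right this (by positivity)
  have hlim : Tendsto (fun z : ℝ => 22 * C * z) (𝓝[>] 0) (𝓝 0) := by
    have : Tendsto (fun z : ℝ => 22 * C * z) (𝓝 0) (𝓝 (22 * C * 0)) := tendsto_id.const_mul _
    rw [mul_zero] at this
    exact this.mono_left nhdsWithin_le_nhds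
  have := ge_of_tendsto hlim (eventually_nhdsWithin_of_forall fun z hz => hd z hz)
  exact abs_nonpos_iff.1 this

lemma two_mul_tsum_h_cube_add_tsum_h3 :
    2 * ∑' k : ℕ, h (k + 1) ^ 3 / ((k : ℝ) + 1) ^ 2 + ∑' k : ℕ, h3 (k + 1) / ((k : ℝ) + 1) ^ 2 =
      12 * oddZeta 5 := by
  set A : ℕ → ℝ := fun m => ∑' k : ℕ, h (k + 1) ^ m / ((k : ℝ) + 1) ^ 2 with hA
  set T := ∑' k : ℕ, h3 (k + 1) / ((k : ℝ) + 1) ^ 2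
  set L := ∑' k : ℕ, (-1 : ℝ) ^ (k + 1) / ((k : ℝ) + 1) ^ 2
  have key := cubic_coeff_eq_zero (a := A 0 - 2 * oddZeta 2 - L) (b := -2 * A 1 + 4 * oddZeta 3)
    (c := 2 * A 2 - 6 * oddZeta 4) (d := -(4 / 3 * A 3 + 2 / 3 * T) + 8 * oddZeta 5)
    (C := 2 * A 4 + 10 * oddZeta 6) fun z hz => by
      have h1 := abs_le.1 (abs_ratioSeries_sub_taylor_le hz)
      have h2 := abs_le.1 (abs_shiftedSquares_sub_taylor_le hz)
      have h3 := ratioSeries_eq hz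
      rw [abs_le]
      simp only [hA]
      constructor <;> nlinarith
  change 2 * A 3 + T = _
  linarith

lemma summable_one_div_int_odd_pow {s : ℕ} (hs : 1 < s) :
    Summable fun k : ℤ => (1 : ℝ) / (2 * (k : ℝ) + 1) ^ s := by
  have := (Real.summable_one_div_int_pow.2 hs).comp_injective
    (i := fun k : ℤ => 2 * k + 1) (fun a b hab => by simp at hab; omega)
  simpa [Function.comp_def] using this

lemma hasSum_one_div_int_odd_pow {s : ℕ} (hs : 1 < s) :
    HasSum (fun k : ℤ => (1 : ℝ) / (2 * (k : ℝ) + 1) ^ s) (oddZeta s + (-1) ^ s * oddZeta s) := by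
  have hS : HasSum (fun n : ℕ => (1 : ℝ) / (2 * (n : ℝ) + 1) ^ s) (oddZeta s) :=
    (summable_one_div_odd_pow hs).hasSum
  refine HasSum.of_nat_of_neg_add_one (by simpa using hS)
    ((hS.mul_left ((-1) ^ s)).congr_fun fun n => ?_)
  have : 2 * ((-((n : ℤ) + 1) : ℤ) : ℝ) + 1 = (-1) * (2 * (n : ℝ) + 1) := by push_cast; ring
  rw [this, mul_pow]
  rcases neg_one_pow_eq_or ℝ s with h1 | h1 <;> rw [h1] <;> ring

lemma hasSum_one_div_odd_sub_pow {s : ℕ} (hs : 1 < s) (n : ℕ) :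
    HasSum (fun k : ℤ => (1 : ℝ) / (2 * (n : ℝ) + 1 - 2 * k) ^ s)
      (oddZeta s + (-1) ^ s * oddZeta s) := by
  convert (Equiv.subLeft (n : ℤ)).hasSum_iff.2 (hasSum_one_div_int_odd_pow hs) using 2 with k
  simp only [Function.comp_apply, Equiv.subLeft_apply]
  push_cast
  ring_nf

lemma odd_sub_two_mul_ne_zero (n : ℕ) (k : ℤ) : 2 * (n : ℝ) + 1 - 2 * k ≠ 0 := by
  intro h0
  have : (2 * (n : ℤ) + 1 - 2 * k : ℤ) = 0 := by exact_mod_cast h0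
  omega

lemma hasSum_one_div_int_sq : HasSum (fun k : ℤ => (1 : ℝ) / (k : ℝ) ^ 2) (2 * zeta 2) := by
  have hS : HasSum (fun k : ℕ => (1 : ℝ) / ((k : ℝ) + 1) ^ 2) (zeta 2) :=
    summable_one_div_succ_sq.hasSum
  have := HasSum.of_add_one_of_neg_add_one (f := fun k : ℤ => (1 : ℝ) / (k : ℝ) ^ 2)
    (by simpa using hS) (m' := zeta 2) (by
      convert hS using 2 with k
      push_cast
      ring)
  convert this using 1
  simp
  ring

lemma summable_inv_add_two_div (n : ℕ) :
    Summable fun k : ℤ => 1 / (k : ℝ) + 2 / (2 * (n : ℝ) + 1 - 2 * k) := by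
  have ha : (0 : ℝ) < 2 * (n : ℝ) + 1 := by positivity
  refine Summable.of_norm_bounded ((hasSum_one_div_int_sq.add
    (hasSum_one_div_odd_sub_pow one_lt_two n)).mul_left (2 * (2 * (n : ℝ) + 1))).summable
    fun k => ?_
  have hb := odd_sub_two_mul_ne_zero n k
  rcases eq_or_ne k 0 with rfl | hk
  · rw [Real.norm_eq_abs, abs_of_nonneg (by simp; positivity)]
    simp
    field_simp
    exact le_rfl
  · have hk' : (k : ℝ) ≠ 0 := by exact_mod_cast hk
    have : 1 / (k : ℝ) + 2 / (2 * (n : ℝ) + 1 - 2 * k) =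
        (2 * (n : ℝ) + 1) * (1 / (k : ℝ) * (1 / (2 * (n : ℝ) + 1 - 2 * k))) := by
      generalize hy : 2 * (n : ℝ) + 1 - 2 * k = y at hb ⊢
      rw [show 2 * (n : ℝ) + 1 = y + 2 * k by linarith]
      field_simp
    rw [this, Real.norm_eq_abs, abs_mul, abs_of_pos ha, mul_comm 2 (2 * (n : ℝ) + 1),
      mul_assoc _ (2 : ℝ), ← one_div_pow, ← one_div_pow]
    refine mul_le_mul_of_nonneg_left ?_ ha.le
    rw [abs_le]
    generalize 1 / (k : ℝ) = x
    generalize 1 / (2 * (n : ℝ) + 1 - 2 * k) = y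
    constructor <;> nlinarith [sq_nonneg (x - y), sq_nonneg (x + y), sq_nonneg x, sq_nonneg y]

lemma tsum_pnat_half_odd (n : ℕ) :
    ∑' k : ℕ+, (1 / ((2 * (n : ℝ) + 1) / 2 - k) + 1 / ((2 * (n : ℝ) + 1) / 2 + k)) =
      -(2 / (2 * (n : ℝ) + 1)) := by
  have hx : ((2 * (n : ℂ) + 1) / 2) ∈ Complex.integerComplement := by
    rintro ⟨m, hm⟩
    have h1 : (2 * m : ℂ) = 2 * (n : ℂ) + 1 := by rw [hm]; ring
    have : (2 * m : ℤ) = 2 * (n : ℤ) + 1 := by exact_mod_cast h1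
    omega
  have hcos : Complex.cos (π * ((2 * (n : ℂ) + 1) / 2)) = 0 :=
    Complex.cos_eq_zero_iff.2 ⟨n, by push_cast; ring⟩
  have hcot := cot_series_rep hx
  rw [Complex.cot_eq_cos_div_sin, hcos, zero_div, mul_zero, one_div_div] at hcot
  have := (eq_neg_of_add_eq_zero_right hcot.symm)
  apply Complex.ofReal_injective
  push_cast
  exact this

lemma tsum_inv_add_two_div (n : ℕ) :
    ∑' k : ℤ, (1 / (k : ℝ) + 2 / (2 * (n : ℝ) + 1 - 2 * k)) = 0 := by
  have hS := summable_inv_add_two_div n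
  have hp : Summable fun k : ℕ+ => 1 / (((k : ℕ) : ℤ) : ℝ) +
      2 / (2 * (n : ℝ) + 1 - 2 * ((k : ℕ) : ℤ)) :=
    hS.comp_injective (i := fun k : ℕ+ => ((k : ℕ) : ℤ)) fun a b hab => by simpa using hab
  have hm : Summable fun k : ℕ+ => 1 / ((-((k : ℕ) : ℤ) : ℤ) : ℝ) +
      2 / (2 * (n : ℝ) + 1 - 2 * (-((k : ℕ) : ℤ) : ℤ)) :=
    hS.comp_injective (i := fun k : ℕ+ => -((k : ℕ) : ℤ)) fun a b hab => by simpa using hab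
  have key := tsum_int_eq_zero_add_tsum_pnat hS
  rw [key, add_assoc, ← hp.tsum_add hm]
  have : ∀ k : ℕ+, 1 / (((k : ℕ) : ℤ) : ℝ) + 2 / (2 * (n : ℝ) + 1 - 2 * ((k : ℕ) : ℤ)) +
      (1 / ((-((k : ℕ) : ℤ) : ℤ) : ℝ) + 2 / (2 * (n : ℝ) + 1 - 2 * (-((k : ℕ) : ℤ) : ℤ))) =
      1 / ((2 * (n : ℝ) + 1) / 2 - k) + 1 / ((2 * (n : ℝ) + 1) / 2 + k) := by
    intro k
    have h1 := odd_sub_two_mul_ne_zero n ((k : ℕ) : ℤ)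
    push_cast at h1 ⊢
    have hk : ((k : ℕ) : ℝ) ≠ 0 := by exact_mod_cast k.ne_zero
    have h2 : 2 * (n : ℝ) + 1 + 2 * (k : ℕ) ≠ 0 := by positivity
    have h3 : (2 * (n : ℝ) + 1) / 2 - (k : ℕ) = (2 * (n : ℝ) + 1 - 2 * (k : ℕ)) / 2 := by ring
    have h4 : (2 * (n : ℝ) + 1) / 2 + (k : ℕ) = (2 * (n : ℝ) + 1 + 2 * (k : ℕ)) / 2 := by ring
    rw [h3, h4, mul_neg, sub_neg_eq_add, one_div_div, one_div_div, div_neg]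
    ring
  rw [tsum_congr this, tsum_pnat_half_odd]
  simp

/-- The terms of a double series evaluated by summing in either order. -/
noncomputable def mixedTerm (k : ℤ) (n : ℕ) : ℝ :=
  1 / (k : ℝ) ^ 2 * (1 / (2 * (n : ℝ) + 1 - 2 * k) ^ 3)

lemma summable_mixedTerm : Summable fun p : ℤ × ℕ => mixedTerm p.1 p.2 := by
  have h1 := summable_mul_of_summable_norm hasSum_one_div_int_sq.summable.norm
    (summable_one_div_int_odd_pow (s := 3) (by norm_num)).norm
  have h2 := h1.comp_injective (i := fun p : ℤ × ℕ => (p.1, (p.2 : ℤ) - p.1)) (by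
    rintro ⟨a, b⟩ ⟨c, d⟩ hab
    simp only [Prod.mk.injEq] at hab ⊢
    omega)
  refine h2.congr fun p => ?_
  simp only [Function.comp_apply, mixedTerm]
  push_cast
  ring_nf

lemma mixedTerm_eq (k : ℤ) (n : ℕ) :
    mixedTerm k n = 1 / (2 * (n : ℝ) + 1) ^ 3 * (1 / (k : ℝ) ^ 2) +
      4 / (2 * (n : ℝ) + 1) ^ 2 * (1 / (2 * (n : ℝ) + 1 - 2 * k) ^ 3) +
      8 / (2 * (n : ℝ) + 1) ^ 3 * (1 / (2 * (n : ℝ) + 1 - 2 * k) ^ 2) +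
      6 / (2 * (n : ℝ) + 1) ^ 4 * (1 / (k : ℝ) + 2 / (2 * (n : ℝ) + 1 - 2 * k)) -
      (if k = 0 then 24 / (2 * (n : ℝ) + 1) ^ 5 else 0) := by
  have ha : 2 * (n : ℝ) + 1 ≠ 0 := by positivity
  have hb := odd_sub_two_mul_ne_zero n k
  rw [mixedTerm]
  generalize 2 * (n : ℝ) + 1 = a at *
  rcases eq_or_ne k 0 with rfl | hk
  · simp
    field_simp
    ring
  · have hk' : (k : ℝ) ≠ 0 := by exact_mod_cast hk
    rw [if_neg hk]
    generalize hy : a - 2 * (k : ℝ) = y at hb ⊢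
    field_simp
    rw [← hy]
    ring

lemma tsum_int_mixedTerm (n : ℕ) :
    ∑' k : ℤ, mixedTerm k n = (2 * zeta 2 + 16 * oddZeta 2) * (1 / (2 * (n : ℝ) + 1) ^ 3) -
      24 * (1 / (2 * (n : ℝ) + 1) ^ 5) := by
  simp_rw [mixedTerm_eq]
  have hG : HasSum (fun k : ℤ => 1 / (k : ℝ) + 2 / (2 * (n : ℝ) + 1 - 2 * k)) 0 :=
    tsum_inv_add_two_div n ▸ (summable_inv_add_two_div n).hasSum
  have := (((((hasSum_one_div_int_sq.mul_left (1 / (2 * (n : ℝ) + 1) ^ 3))).add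
    ((hasSum_one_div_odd_sub_pow (s := 3) (by norm_num) n).mul_left
      (4 / (2 * (n : ℝ) + 1) ^ 2))).add
    ((hasSum_one_div_odd_sub_pow one_lt_two n).mul_left (8 / (2 * (n : ℝ) + 1) ^ 3))).add
    (hG.mul_left (6 / (2 * (n : ℝ) + 1) ^ 4))).sub
    (hasSum_ite_eq (0 : ℤ) (24 / (2 * (n : ℝ) + 1) ^ 5))
  rw [this.tsum_eq]
  ring

lemma tsum_one_div_odd_add (k : ℕ) :
    ∑' n : ℕ, 1 / (2 * (n : ℝ) + 1 + 2 * k) ^ 3 = oddZeta 3 - h3 k := by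
  have := (summable_one_div_odd_pow (s := 3) (by norm_num)).sum_add_tsum_nat_add k
  rw [oddZeta, h3, ← this, add_sub_cancel_left]
  refine tsum_congr fun n => ?_
  push_cast
  ring_nf

lemma sum_range_one_div_odd_sub (k : ℕ) :
    ∑ n ∈ Finset.range k, 1 / (2 * (n : ℝ) + 1 - 2 * k) ^ 3 = -h3 k := by
  rw [h3, ← Finset.sum_range_reflect, ← Finset.sum_neg_distrib]
  refine Finset.sum_congr rfl fun j hj => ?_
  have hj' : j + 1 ≤ k := Finset.mem_range.1 hj
  have : 2 * ((k - 1 - j : ℕ) : ℝ) + 1 - 2 * k = -(2 * (j : ℝ) + 1) := by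
    rw [Nat.sub_sub, Nat.cast_sub (by omega)]
    push_cast
    ring
  rw [this, Odd.neg_pow (by decide), div_neg]

lemma tsum_one_div_odd_sub (k : ℕ) :
    ∑' n : ℕ, 1 / (2 * (n : ℝ) + 1 - 2 * k) ^ 3 = oddZeta 3 - h3 k := by
  have hs : Summable fun n : ℕ => 1 / (2 * (n : ℝ) + 1 - 2 * k) ^ 3 := by
    have := (summable_one_div_int_odd_pow (s := 3) (by norm_num)).comp_injective
      (i := fun n : ℕ => (n : ℤ) - k) fun a b hab => by simpa using hab
    refine this.congr fun n => ?_
    simp only [Function.comp_apply]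
    push_cast
    ring_nf
  rw [← hs.sum_add_tsum_nat_add k, sum_range_one_div_odd_sub, oddZeta, sub_eq_neg_add]
  congr 1
  refine tsum_congr fun n => ?_
  push_cast
  ring_nf

lemma tsum_int_tsum_mixedTerm :
    ∑' k : ℤ, ∑' n : ℕ, mixedTerm k n =
      2 * (oddZeta 3 * zeta 2 - ∑' k : ℕ, h3 (k + 1) / ((k : ℝ) + 1) ^ 2) := by
  have hS := (summable_one_div_succ_sq.hasSum.mul_left (oddZeta 3)).sub summable_h3.hasSum
  simp_rw [mixedTerm, tsum_mul_left]
  have := HasSum.of_add_one_of_neg_add_one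
    (f := fun k : ℤ => 1 / (k : ℝ) ^ 2 * ∑' n : ℕ, 1 / (2 * (n : ℝ) + 1 - 2 * k) ^ 3)
    (hS.congr_fun fun k => by
      have := tsum_one_div_odd_sub (k + 1)
      push_cast at this ⊢
      rw [this]
      ring)
    (hS.congr_fun fun k => by
      have := tsum_one_div_odd_add (k + 1)
      push_cast at this ⊢
      simp_rw [mul_neg, sub_neg_eq_add, this]
      ring)
  rw [this.tsum_eq, zeta]
  simp
  ring

lemma tsum_h3 :
    ∑' k : ℕ, h3 (k + 1) / ((k : ℝ) + 1) ^ 2 =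
      12 * oddZeta 5 - 8 * oddZeta 2 * oddZeta 3 := by
  have hcomm : ∑' n : ℕ, ∑' k : ℤ, mixedTerm k n = ∑' k : ℤ, ∑' n : ℕ, mixedTerm k n :=
    Summable.tsum_comm (f := mixedTerm) summable_mixedTerm
  have hS := ((summable_one_div_odd_pow (s := 3) (by norm_num)).hasSum.mul_left
    (2 * zeta 2 + 16 * oddZeta 2)).sub
    ((summable_one_div_odd_pow (s := 5) (by norm_num)).hasSum.mul_left 24)
  rw [tsum_int_tsum_mixedTerm, tsum_congr tsum_int_mixedTerm, hS.tsum_eq] at hcomm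
  change (2 * zeta 2 + 16 * oddZeta 2) * oddZeta 3 - 24 * oddZeta 5 = _ at hcomm
  linarith

lemma oddZeta_eq {s : ℕ} (hs : 1 < s) : oddZeta s = (1 - 1 / 2 ^ s) * zeta s := by
  have hz : Summable fun n : ℕ => (1 : ℝ) / ((n : ℝ) + 1) ^ s := by
    simpa using (summable_nat_add_iff 1).2 (Real.summable_one_div_nat_pow.2 hs)
  have h1 : HasSum (fun n : ℕ => (1 : ℝ) / (((2 * n : ℕ) : ℝ) + 1) ^ s) (oddZeta s) := by
    simpa [oddZeta] using (summable_one_div_odd_pow hs).hasSum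
  have h2 : HasSum (fun n : ℕ => (1 : ℝ) / (((2 * n + 1 : ℕ) : ℝ) + 1) ^ s)
      (1 / 2 ^ s * zeta s) := by
    refine (hz.hasSum.mul_left (1 / 2 ^ s)).congr_fun fun n => ?_
    rw [one_div_mul_one_div, ← mul_pow]
    push_cast
    ring_nf
  have := (HasSum.even_add_odd (f := fun n : ℕ => (1 : ℝ) / ((n : ℝ) + 1) ^ s) h1 h2).tsum_eq
  rw [← zeta] at this
  linarith

theorem stmt6 :
    HasSum (fun k : ℕ => (h (k + 1)) ^ 3 / ((k : ℝ) + 1) ^ 2)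
      ((21 / 8) * zeta 2 * zeta 3) := by
  have hS := (summable_h_pow (m := 3) (by norm_num)).hasSum
  convert hS using 1
  have h1 := two_mul_tsum_h_cube_add_tsum_h3
  rw [tsum_h3, oddZeta_eq one_lt_two, oddZeta_eq (s := 3) (by norm_num)] at h1
  linarith
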